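/- arXiv:1502.04690 — 5 statements merged into one kernel-verified Lean document; each statement's English description precedes it below -/
import Mathlib

section
/- Let G be a strongly connected finite directed multigraph on vertex set V with Laplacian Δ. Then the kernel of Δ acting on ℤ^V equals ℤ·𝟏 (the integer multiples of the all-ones vector) if and only if G is Eulerian, i.e. every vertex has indegree equal to outdegree. -/
open Finset

variable {V : Type} [Fintype V] [DecidableEq V]

/-- Outdegree of `v`. -/
def outdeg (d : V → V → ℕ) (v : V) : ℕ := ∑ w, d v w

/-- Indegree of `v`. -/
def indeg (d : V → V → ℕ) (v : V) : ℕ := ∑ w, d w v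

/-- The graph Laplacian. -/
def lap (d : V → V → ℕ) : Matrix V V ℤ :=
  Matrix.of fun v w => if v = w then (outdeg d v : ℤ) - d v v else -(d w v : ℤ)

/-- Strong connectivity. -/
def StronglyConnected (d : V → V → ℕ) : Prop :=
  ∀ u v : V, Relation.ReflTransGen (fun a b => 1 ≤ d a b) u v

/-- Eulerian: every vertex has indegree equal to outdegree. -/
def Eulerian (d : V → V → ℕ) : Prop := ∀ v, indeg d v = outdeg d v

/-- Reduced Laplacian with the row and column of `s` deleted. -/
def redLap (d : V → V → ℕ) (s : V) : Matrix {v : V // v ≠ s} {v : V // v ≠ s} ℤ :=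
  Matrix.of fun v w => lap d v.1 w.1

/-- Number of oriented spanning trees rooted at `s` (matrix-tree theorem). -/
def kappa (d : V → V → ℕ) (s : V) : ℤ := (redLap d s).det

/-- Pham index. -/
def phamIndex (d : V → V → ℕ) : ℤ := Finset.univ.gcd (kappa d)

/-- Integer column span of the Laplacian. -/
def lapLattice (d : V → V → ℕ) : Submodule ℤ (V → ℤ) :=
  LinearMap.range (lap d).mulVecLin

/-- Integer column span of the reduced Laplacian. -/
def redLattice (d : V → V → ℕ) (s : V) : Submodule ℤ ({v : V // v ≠ s} → ℤ) :=
  LinearMap.range (redLap d s).mulVecLin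

/-- Integer vectors with coordinate sum zero. -/
def zeroSum (V : Type) [Fintype V] : Submodule ℤ (V → ℤ) where
  carrier := {f | ∑ v, f v = 0}
  add_mem' := by
    intro a b ha hb
    simp only [Set.mem_setOf_eq] at *
    simp [Finset.sum_add_distrib, ha, hb]
  zero_mem' := by simp
  smul_mem' := by
    intro c f hf
    simp only [Set.mem_setOf_eq, Pi.smul_apply, smul_eq_mul] at *
    simp [← Finset.mul_sum, hf]

/-- The sandpile `β_s`, recording edge multiplicities out of `s`. -/
def betaS (d : V → V → ℕ) (s : V) : {v : V // v ≠ s} → ℤ := fun v => (d s v.1 : ℤ)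

/-- Stable chip configuration. -/
def Stable (d : V → V → ℕ) (σ : V → ℤ) : Prop := ∀ v, σ v < (outdeg d v : ℤ)

/-- Result of firing vertex `v`. -/
def fire (d : V → V → ℕ) (σ : V → ℤ) (v : V) : V → ℤ := fun w => σ w - lap d w v

/-- One legal firing step. -/
def LegalStep (d : V → V → ℕ) (σ τ : V → ℤ) : Prop :=
  ∃ v, (outdeg d v : ℤ) ≤ σ v ∧ τ = fire d σ v

/-- `σ` stabilizes if some legal firing sequence from `σ` ends in a stable configuration. -/
def Stabilizes (d : V → V → ℕ) (σ : V → ℤ) : Prop :=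
  ∃ τ, Relation.ReflTransGen (LegalStep d) σ τ ∧ Stable d τ

/-- Legal firing sequences, recorded as lists of fired vertices. -/
inductive LegalSeq (d : V → V → ℕ) : (V → ℤ) → List V → Prop
  | nil (σ : V → ℤ) : LegalSeq d σ []
  | cons (σ : V → ℤ) (v : V) (l : List V) :
      (outdeg d v : ℤ) ≤ σ v → LegalSeq d (fire d σ v) l → LegalSeq d σ (v :: l)

/-- Period vector. -/
def IsPeriodVec (d : V → V → ℕ) (p : V → ℕ) : Prop :=
  p ≠ 0 ∧ (lap d).mulVec (fun v => (p v : ℤ)) = 0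

/-- Simple directed path from `x` to `y`, as a list of distinct vertices. -/
def IsSimplePath (d : V → V → ℕ) (x y : V) (p : List V) : Prop :=
  p.Nodup ∧ p.head? = some x ∧ p.getLast? = some y ∧ p.Chain' (fun a b => 1 ≤ d a b)

/-- The Laplacian acts by `(Δ f) v = outdeg v * f v - ∑ w, d w v * f w`. -/
theorem lap_mulVec_apply (d : V → V → ℕ) (f : V → ℤ) (v : V) :
    (lap d).mulVec f v = (outdeg d v : ℤ) * f v - ∑ w, (d w v : ℤ) * f w := by
  have hrow : ∀ w, lap d v w * f w =
      (if v = w then (outdeg d v : ℤ) * f w else 0) - (d w v : ℤ) * f w := by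
    intro w
    by_cases hvw : v = w
    · subst hvw
      simp [lap, sub_mul]
    · simp [lap, hvw]
  simp only [Matrix.mulVec, dotProduct, hrow, Finset.sum_sub_distrib, Finset.sum_ite_eq,
    Finset.mem_univ, if_true]

theorem lap_mulVec_one (d : V → V → ℕ) (v : V) :
    (lap d).mulVec (fun _ => 1) v = (outdeg d v : ℤ) - indeg d v := by
  simp [lap_mulVec_apply, indeg]

/-- In an Eulerian graph the Laplacian sums the differences along incoming edges. -/
theorem Eulerian.lap_mulVec_apply {d : V → V → ℕ} (hd : Eulerian d) (f : V → ℤ) (v : V) :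
    (lap d).mulVec f v = ∑ w, (d w v : ℤ) * (f v - f w) := by
  rw [_root_.lap_mulVec_apply, ← hd v, indeg]
  simp [mul_sub, Finset.sum_sub_distrib, Finset.sum_mul]

/-- Maximum principle: a harmonic function on a strongly connected Eulerian graph is constant. -/
theorem StronglyConnected.eq_of_lap_mulVec_eq_zero {d : V → V → ℕ} (h : StronglyConnected d)
    (hd : Eulerian d) {f : V → ℤ} (hf : (lap d).mulVec f = 0) {m : V} (hm : ∀ w, f w ≤ f m)
    (u : V) : f u = f m := by
  refine Relation.ReflTransGen.head_induction_on (h u m) rfl ?_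
  intro a b hab _ hb
  have hsum : ∑ w, (d w b : ℤ) * (f b - f w) = 0 := by
    rw [← hd.lap_mulVec_apply, hf, Pi.zero_apply]
  have hnonneg : ∀ w ∈ Finset.univ, 0 ≤ (d w b : ℤ) * (f b - f w) := fun w _ =>
    mul_nonneg (Int.natCast_nonneg _) (by have := hm w; omega)
  have hterm := (Finset.sum_eq_zero_iff_of_nonneg hnonneg).1 hsum a (Finset.mem_univ a)
  rcases mul_eq_zero.1 hterm with h0 | h0 <;> omega

theorem stmt0 (d : V → V → ℕ) (h : StronglyConnected d) :
    LinearMap.ker (lap d).mulVecLin = Submodule.span ℤ {fun _ => (1 : ℤ)} ↔ Eulerian d := by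
  constructor
  · intro hker v
    have hone : (fun _ => (1 : ℤ)) ∈ LinearMap.ker (lap d).mulVecLin :=
      hker ▸ Submodule.mem_span_singleton_self _
    have hv := congrFun (LinearMap.mem_ker.1 hone) v
    rw [Matrix.mulVecLin_apply, lap_mulVec_one, Pi.zero_apply] at hv
    omega
  · intro hd
    apply le_antisymm
    · intro f hf
      rw [LinearMap.mem_ker, Matrix.mulVecLin_apply] at hf
      rw [Submodule.mem_span_singleton]
      rcases isEmpty_or_nonempty V with hV | hV
      · exact ⟨0, Subsingleton.elim _ _⟩
      · obtain ⟨m, hm⟩ := Finite.exists_max f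
        refine ⟨f m, funext fun u => ?_⟩
        simp [h.eq_of_lap_mulVec_eq_zero hd hf hm u]
    · rw [Submodule.span_singleton_le_iff_mem, LinearMap.mem_ker, Matrix.mulVecLin_apply]
      funext v
      rw [lap_mulVec_one, hd v, sub_self, Pi.zero_apply]
end

section
/- Let G be a strongly connected finite directed multigraph on vertex set V. Then M_G = κ(s) for every s ∈ V (equivalently, κ is constant on V) if and only if G is Eulerian, i.e. every vertex has indegree equal to outdegree. -/
open Finset

variable {V : Type} [Fintype V] [DecidableEq V]

/-- A real matrix that is weakly column diagonally dominant, with nonnegative diagonal, has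
nonnegative determinant. -/
theorem det_nonneg_of_sum_col_le_diag {n : Type*} [Fintype n] [DecidableEq n] (A : Matrix n n ℝ)
    (h : ∀ k, ∑ i ∈ univ.erase k, |A i k| ≤ A k k) : 0 ≤ A.det := by
  cases isEmpty_or_nonempty n
  · simp
  have heval (t : ℝ) : (-A).charpoly.eval t = (Matrix.scalar n t + A).det := by
    rw [Matrix.eval_charpoly, sub_neg_eq_add]
  have hne (t : ℝ) (ht : 0 < t) : (-A).charpoly.eval t ≠ 0 := by
    rw [heval]
    refine det_ne_zero_of_sum_col_lt_diag fun k => ?_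
    have hsum : ∑ i ∈ univ.erase k, ‖(Matrix.scalar n t + A) i k‖ = ∑ i ∈ univ.erase k, |A i k| :=
      sum_congr rfl fun i hi => by simp [Matrix.diagonal_apply_ne _ (ne_of_mem_erase hi)]
    have hk : 0 ≤ A k k := (sum_nonneg fun _ _ => abs_nonneg _).trans (h k)
    rw [hsum, Real.norm_eq_abs, Matrix.add_apply, Matrix.scalar_apply, Matrix.diagonal_apply_eq,
      abs_of_pos (by linarith)]
    linarith [h k]
  by_contra! hneg
  have htop := (-A).charpoly.tendsto_atTop_of_leadingCoeff_nonneg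
    (by rw [Matrix.charpoly_degree_eq_dim]; exact_mod_cast Fintype.card_pos)
    (by rw [(Matrix.charpoly_monic _).leadingCoeff]; exact zero_le_one)
  obtain ⟨b, hb, hb0⟩ :=
    ((htop.eventually_ge_atTop 0).and (Filter.eventually_ge_atTop 0)).exists
  obtain ⟨t, ht, hroot⟩ := intermediate_value_Icc hb0 (-A).charpoly.continuous.continuousOn
    (show (0 : ℝ) ∈ Set.Icc _ _ from ⟨by rw [heval]; simpa using hneg.le, hb⟩)
  rcases ht.1.eq_or_lt with rfl | h0
  · simp [heval, hneg.ne] at hroot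
  · exact hne t h0 hroot

theorem lap_apply (d : V → V → ℕ) (v w : V) :
    lap d v w = (if v = w then (outdeg d v : ℤ) else 0) - d w v := by
  simp only [lap, Matrix.of_apply]
  split_ifs with hv
  · rw [hv]
  · ring

theorem vecMul_lap (d : V → V → ℕ) (x : V → ℤ) (w : V) :
    Matrix.vecMul x (lap d) w = ∑ v, (d w v : ℤ) * (x w - x v) := by
  simp only [Matrix.vecMul, dotProduct, lap_apply, mul_sub, mul_ite, mul_zero, sum_sub_distrib,
    sum_ite_eq', mem_univ, if_true, outdeg, Nat.cast_sum, ← sum_mul]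
  simp only [mul_comm]

/-- Maximum principle for functions harmonic away from `s`. -/
theorem le_of_harmonic {d : V → V → ℕ} (h : StronglyConnected d) (s : V) (x : V → ℤ)
    (hx : ∀ w, w ≠ s → ∑ v, (d w v : ℤ) * (x w - x v) = 0) (v : V) : x v ≤ x s := by
  obtain ⟨m, -, hm⟩ := exists_max_image univ x ⟨s, mem_univ s⟩
  suffices x s = x m from this ▸ hm v (mem_univ v)
  have key (a : V) (ha : Relation.ReflTransGen (fun a b => 1 ≤ d a b) a s) :
      x a = x m → x s = x m := by
    induction ha using Relation.ReflTransGen.head_induction_on with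
    | refl => exact id
    | @head a b hab _ ih =>
      intro hxa
      by_cases has : a = s
      · exact has ▸ hxa
      have h0 := (sum_eq_zero_iff_of_nonneg fun v _ =>
        mul_nonneg (Int.natCast_nonneg _) (by rw [hxa]; exact sub_nonneg.2 (hm v (mem_univ v)))).1
        (hx a has) b (mem_univ b)
      rcases mul_eq_zero.1 h0 with h1 | h1
      · have : d a b = 0 := by exact_mod_cast h1
        omega
      · exact ih (by omega)
  exact key m (h m s) rfl

theorem eq_of_harmonic {d : V → V → ℕ} (h : StronglyConnected d) (s : V) (x : V → ℤ)
    (hx : ∀ w, w ≠ s → Matrix.vecMul x (lap d) w = 0) (v : V) : x v = x s := by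
  simp only [vecMul_lap] at hx
  refine le_antisymm (le_of_harmonic h s x hx v) (neg_le_neg_iff.1 ?_)
  refine le_of_harmonic h s (fun v => -x v) (fun w hw => ?_) v
  rw [← neg_eq_zero, ← hx w hw, ← sum_neg_distrib]
  exact sum_congr rfl fun _ _ => by ring

theorem det_updateCol_lap (d : V → V → ℕ) (s : V) :
    ((lap d).updateCol s (Pi.single s 1)).det = kappa d s := by
  rw [Matrix.twoBlockTriangular_det' _ (fun v => v ≠ s)]
  · refine (congrArg₂ (· * ·) (congrArg Matrix.det ?_)
      ((congrArg Matrix.det ?_).trans Matrix.det_one)).trans (mul_one _)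
    · ext i j
      simp [Matrix.toSquareBlockProp, redLap, Matrix.updateCol_ne j.2]
    · ext ⟨i, hi⟩ ⟨j, hj⟩
      obtain rfl := not_not.1 hi
      obtain rfl := not_not.1 hj
      simp [Matrix.toSquareBlockProp]
  · intro i hi j hj
    obtain rfl := not_not.1 hj
    simp [hi]

theorem kappa_nonneg (d : V → V → ℕ) (s : V) : 0 ≤ kappa d s := by
  rw [← det_updateCol_lap, ← Int.cast_nonneg_iff (R := ℝ), Int.cast_det]
  refine det_nonneg_of_sum_col_le_diag _ fun k => ?_
  simp only [Matrix.map_apply]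
  by_cases hk : k = s
  · subst hk
    rw [sum_eq_zero fun i hi => by simp [ne_of_mem_erase hi]]
    simp
  · simp only [Matrix.updateCol_ne hk]
    rw [sum_congr rfl fun i hi => show |((lap d i k : ℤ) : ℝ)| = d k i by
      simp [lap, ne_of_mem_erase hi], sum_erase_eq_sub (mem_univ k)]
    simp [lap, outdeg]

theorem kappa_ne_zero {d : V → V → ℕ} (h : StronglyConnected d) (s : V) : kappa d s ≠ 0 := by
  rw [← det_updateCol_lap]
  intro h0
  obtain ⟨x, hx0, hx⟩ := Matrix.exists_vecMul_eq_zero_iff.2 h0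
  have hs : x s = 0 := by simpa [Matrix.vecMul, dotProduct, Pi.single_apply] using congrFun hx s
  refine hx0 (funext fun v => (eq_of_harmonic h s x (fun w hw => ?_) v).trans hs)
  have := congrFun hx w
  simpa [Matrix.vecMul, dotProduct, Matrix.updateCol_ne hw] using this

theorem adjugate_lap_self (d : V → V → ℕ) (s : V) : (lap d).adjugate s s = kappa d s := by
  rw [← det_updateCol_lap, ← Matrix.det_transpose, ← Matrix.updateRow_transpose,
    ← Matrix.adjugate_apply, ← Matrix.adjugate_transpose, Matrix.transpose_apply]

theorem det_lap [Nonempty V] (d : V → V → ℕ) : (lap d).det = 0 :=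
  Matrix.exists_vecMul_eq_zero_iff.1 ⟨1, one_ne_zero, funext fun w => by simp [vecMul_lap]⟩

theorem adjugate_lap_apply {d : V → V → ℕ} (h : StronglyConnected d) (s t : V) :
    (lap d).adjugate s t = kappa d s := by
  have : Nonempty V := ⟨s⟩
  rw [← adjugate_lap_self]
  refine eq_of_harmonic h s ((lap d).adjugate s) (fun w _ => ?_) t
  have := congrFun (congrFun (Matrix.adjugate_mul (lap d)) s) w
  rwa [det_lap, zero_smul] at this

theorem sum_lap_row (d : V → V → ℕ) (v : V) :
    ∑ w, lap d v w = outdeg d v - indeg d v := by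
  simp [lap_apply, sum_sub_distrib, indeg]

theorem sum_lap_mul_kappa {d : V → V → ℕ} (h : StronglyConnected d) (v : V) :
    ∑ w, lap d v w * kappa d w = 0 := by
  have : Nonempty V := ⟨v⟩
  have := congrFun (congrFun (Matrix.mul_adjugate (lap d)) v) v
  simpa [det_lap, Matrix.mul_apply, adjugate_lap_apply h] using this

theorem StronglyConnected.reverse {W : Type} {d : W → W → ℕ} (h : StronglyConnected d) :
    StronglyConnected fun u v => d v u :=
  fun u v => Relation.reflTransGen_swap.1 (h v u)

theorem Eulerian.lap_reverse {d : V → V → ℕ} (hE : Eulerian d) :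
    lap (fun u v => d v u) = (lap d).transpose := by
  ext v w
  by_cases hvw : v = w
  · subst hvw
    simpa [lap, outdeg, indeg] using congrArg (Nat.cast (R := ℤ)) (hE v)
  · simp [lap, hvw, Ne.symm hvw]

theorem Eulerian.kappa_eq {d : V → V → ℕ} (hE : Eulerian d) (h : StronglyConnected d) (s t : V) :
    kappa d s = kappa d t := by
  have ht : kappa (fun u v => d v u) t = kappa d t := by
    rw [← adjugate_lap_self, ← adjugate_lap_self, hE.lap_reverse, ← Matrix.adjugate_transpose,
      Matrix.transpose_apply]
  rw [← ht, ← adjugate_lap_apply h.reverse t s, hE.lap_reverse, ← Matrix.adjugate_transpose,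
    Matrix.transpose_apply, adjugate_lap_apply h]

theorem stmt1 (d : V → V → ℕ) (h : StronglyConnected d) :
    (∀ s : V, phamIndex d = kappa d s) ↔ Eulerian d := by
  constructor
  · intro hM v
    have hsum := sum_lap_mul_kappa h v
    simp only [← hM, ← sum_mul, sum_lap_row] at hsum
    have := (mul_eq_zero.1 hsum).resolve_right (hM v ▸ kappa_ne_zero h v)
    omega
  · intro hE s
    refine Int.dvd_antisymm ?_ (kappa_nonneg d s) (gcd_dvd (mem_univ s))
      (dvd_gcd fun t _ => (hE.kappa_eq h s t).dvd)
    exact Int.nonneg_of_normalize_eq_self normalize_gcd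
end

section
/- Let G be a strongly connected finite directed multigraph on vertex set V and let s ∈ V. Then there is a group isomorphism K(G,s)/⟨β̄_s⟩ ≅ ℤ^V_0 / Δℤ^V, where ⟨β̄_s⟩ is the cyclic subgroup of the sandpile group generated by β̄_s. -/
open Finset

variable {V : Type} [Fintype V] [DecidableEq V]

/-- Extend a vector on `V ∖ {s}` to `V` by the value at `s` that makes the coordinate sum zero. -/
def zeroSumExtend (s : V) : ({v : V // v ≠ s} → ℤ) →ₗ[ℤ] zeroSum V where
  toFun y := ⟨fun v => if hv : v = s then -∑ w, y w else y ⟨v, hv⟩, by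
    change ∑ v, _ = 0
    rw [Fintype.sum_eq_add_sum_subtype_ne _ s]
    have : ∀ w : {v : V // v ≠ s},
        (if hv : w.1 = s then -∑ w, y w else y ⟨w.1, hv⟩) = y w := fun w => dif_neg w.2
    simp [this]⟩
  map_add' x y := by
    ext v
    by_cases hv : v = s
    · simp only [hv, dite_true, Pi.add_apply, sum_add_distrib, Submodule.coe_add, neg_add]
    · simp [hv]
  map_smul' c y := by
    ext v
    by_cases hv : v = s
    · simp [hv, mul_sum]
    · simp [hv]

lemma zeroSumExtend_apply (s : V) (y : {v : V // v ≠ s} → ℤ) (w : {v : V // v ≠ s}) :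
    (zeroSumExtend s y : V → ℤ) w = y w := dif_neg w.2

/-- A zero-sum vector is determined by its coordinates away from `s`. -/
lemma zeroSum_ext_of_ne {x y : V → ℤ} (hx : x ∈ zeroSum V) (hy : y ∈ zeroSum V) (s : V)
    (hxy : ∀ v, v ≠ s → x v = y v) : x = y := by
  have hx' : ∑ v, x v = 0 := hx
  have hy' : ∑ v, y v = 0 := hy
  rw [Fintype.sum_eq_add_sum_subtype_ne _ s] at hx' hy'
  have hsum : ∑ w : {v : V // v ≠ s}, x w = ∑ w : {v : V // v ≠ s}, y w :=
    sum_congr rfl fun w _ => hxy w w.2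
  ext v
  by_cases hv : v = s
  · subst hv
    linarith
  · exact hxy v hv

lemma zeroSumExtend_surjective (s : V) : Function.Surjective (zeroSumExtend s) := fun z =>
  ⟨fun w => z.1 w, Subtype.ext <| zeroSum_ext_of_ne (zeroSumExtend s _).2 z.2 s
    fun v hv => zeroSumExtend_apply s _ ⟨v, hv⟩⟩

lemma sum_lap (d : V → V → ℕ) (w : V) : ∑ v, lap d v w = 0 := by
  have hterm : ∀ v, lap d v w = (if v = w then (outdeg d w : ℤ) else 0) - d w v := by
    intro v
    by_cases hv : v = w
    · subst hv
      simp [lap]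
    · simp [lap, hv]
  simp [hterm, outdeg]

lemma lap_mulVec_mem_zeroSum (d : V → V → ℕ) (x : V → ℤ) : (lap d).mulVec x ∈ zeroSum V := by
  change ∑ v, ∑ w, lap d v w * x w = 0
  rw [sum_comm]
  simp [← sum_mul, sum_lap]

/-- Away from `s`, the Laplacian is the reduced Laplacian plus a multiple of `β_s`. -/
lemma lap_mulVec_apply_of_ne (d : V → V → ℕ) (s : V) (x : V → ℤ) (w : {v : V // v ≠ s}) :
    (lap d).mulVec x w = (redLap d s).mulVec (fun v => x v) w - x s * betaS d s w := by
  change ∑ v, lap d w v * x v = ∑ v : {v : V // v ≠ s}, lap d w v * x v - x s * (d s w : ℤ)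
  rw [Fintype.sum_eq_add_sum_subtype_ne _ s]
  have : lap d w s = -(d s w : ℤ) := by simp [lap, w.2]
  rw [this]
  ring

lemma zeroSumExtend_mem_lapLattice_iff (d : V → V → ℕ) (s : V) (y : {v : V // v ≠ s} → ℤ) :
    (zeroSumExtend s y : V → ℤ) ∈ lapLattice d ↔ ∃ k : ℤ, y - k • betaS d s ∈ redLattice d s := by
  constructor
  · rintro ⟨x, hx⟩
    refine ⟨-x s, fun v => x v, ?_⟩
    ext w
    have hw := lap_mulVec_apply_of_ne d s x w
    rw [← Matrix.mulVecLin_apply, hx, zeroSumExtend_apply] at hw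
    simp [hw]
  · rintro ⟨k, x, hx⟩
    refine ⟨fun v => if hv : v = s then -k else x ⟨v, hv⟩, ?_⟩
    refine zeroSum_ext_of_ne (lap_mulVec_mem_zeroSum d _) (zeroSumExtend s y).2 s fun v hv => ?_
    have hw := congrFun hx ⟨v, hv⟩
    have hres : (fun w : {v : V // v ≠ s} =>
        if hv : w.1 = s then -k else x ⟨w.1, hv⟩) = x := funext fun w => dif_neg w.2
    rw [Matrix.mulVecLin_apply, lap_mulVec_apply_of_ne d s _ ⟨v, hv⟩, hres,
      zeroSumExtend_apply s y ⟨v, hv⟩]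
    simp only [Matrix.mulVecLin_apply, Pi.sub_apply, Pi.smul_apply, smul_eq_mul] at hw
    simp [hw]

theorem stmt12 (d : V → V → ℕ) (h : StronglyConnected d) (s : V) :
    Nonempty (
      ((({v : V // v ≠ s} → ℤ) ⧸ redLattice d s) ⧸
        AddSubgroup.zmultiples (Submodule.Quotient.mk (p := redLattice d s) (betaS d s))) ≃+
      (↥(zeroSum V) ⧸ (lapLattice d).comap (zeroSum V).subtype)) := by
  let f := ((lapLattice d).comap (zeroSum V).subtype).mkQ ∘ₗ zeroSumExtend s
  have hf : ∀ y, f y = 0 ↔ ∃ k : ℤ, y - k • betaS d s ∈ redLattice d s := fun y => by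
    rw [← zeroSumExtend_mem_lapLattice_iff]
    exact Submodule.Quotient.mk_eq_zero _
  have hle : redLattice d s ≤ LinearMap.ker f := fun y hy => (hf y).2 ⟨0, by simpa using hy⟩
  let g := ((redLattice d s).liftQ f hle).toAddMonoidHom
  have hsurj : Function.Surjective g := fun q => by
    obtain ⟨z, rfl⟩ := Submodule.Quotient.mk_surjective _ q
    obtain ⟨y, rfl⟩ := zeroSumExtend_surjective s z
    exact ⟨Submodule.Quotient.mk y, rfl⟩
  have hker : AddSubgroup.zmultiples (Submodule.Quotient.mk (p := redLattice d s) (betaS d s)) =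
      g.ker := by
    ext q
    obtain ⟨y, rfl⟩ := Submodule.Quotient.mk_surjective _ q
    rw [AddMonoidHom.mem_ker, AddSubgroup.mem_zmultiples_iff]
    change _ ↔ f y = 0
    rw [hf]
    refine exists_congr fun k => ?_
    rw [← Submodule.Quotient.mk_smul, eq_comm, Submodule.Quotient.eq]
  exact ⟨(QuotientAddGroup.quotientAddEquivOfEq hker).trans
    (QuotientAddGroup.quotientKerEquivOfSurjective g hsurj)⟩
end

section
/- (Least Action Principle) Let σ be a chip configuration on a finite directed multigraph G. Then σ stabilizes (i.e. some legal firing sequence from σ ends in a stable configuration) if and only if there exists a vector x ∈ ℕ^V such that σ − Δx is stable. -/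
open Finset

variable {V : Type} [Fintype V] [DecidableEq V]

theorem fire_eq_sub_mulVec (d : V → V → ℕ) (σ : V → ℤ) (v : V) :
    fire d σ v = σ - (lap d).mulVec (Pi.single v 1) := by
  ext w
  simp [fire]

theorem natCast_add_single (x : V → ℕ) (v : V) :
    (fun w => ((x + Pi.single v 1 : V → ℕ) w : ℤ)) =
      (fun w => (x w : ℤ)) + Pi.single v 1 := by
  ext w
  by_cases h : w = v
  · subst h; simp
  · simp [h]

/-- Firing `v` first and then `x` has the same effect as firing `x + δ_v`. -/
theorem fire_sub_mulVec (d : V → V → ℕ) (σ : V → ℤ) (v : V) (x : V → ℕ) :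
    fire d σ v - (lap d).mulVec (fun w => (x w : ℤ)) =
      σ - (lap d).mulVec (fun w => ((x + Pi.single v 1 : V → ℕ) w : ℤ)) := by
  rw [natCast_add_single, Matrix.mulVec_add, fire_eq_sub_mulVec]
  abel

/-- Firing only other vertices never removes chips from `v`. -/
theorem le_sub_mulVec_of_eq_zero (d : V → V → ℕ) (σ : V → ℤ) (v : V) (x : V → ℕ)
    (hx : x v = 0) : σ v ≤ (σ - (lap d).mulVec (fun w => (x w : ℤ))) v := by
  have : (lap d).mulVec (fun w => (x w : ℤ)) v ≤ 0 := by
    refine Finset.sum_nonpos fun w _ => ?_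
    by_cases h : v = w
    · subst h; simp [hx]
    · simp only [lap, Matrix.of_apply, if_neg h]
      exact mul_nonpos_of_nonpos_of_nonneg (by simp) (by simp)
  simpa using this

theorem stabilizes_of_stable_sub_mulVec (d : V → V → ℕ) (n : ℕ) (σ : V → ℤ) (x : V → ℕ)
    (hn : ∑ v, x v = n) (hx : Stable d (σ - (lap d).mulVec (fun v => (x v : ℤ)))) :
    Stabilizes d σ := by
  induction n generalizing σ x with
  | zero =>
    have h0 : x = 0 := by
      ext v
      exact (Finset.sum_eq_zero_iff.mp hn) v (Finset.mem_univ v)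
    subst h0
    refine ⟨σ, .refl, fun v => ?_⟩
    exact (le_sub_mulVec_of_eq_zero d σ v 0 rfl).trans_lt (hx v)
  | succ n ih =>
    by_cases hσ : Stable d σ
    · exact ⟨σ, .refl, hσ⟩
    obtain ⟨v, hv⟩ : ∃ v, (outdeg d v : ℤ) ≤ σ v := by
      simpa [Stable] using hσ
    have hxv : x v ≠ 0 := fun h =>
      absurd (hx v) (not_lt.mpr (hv.trans (le_sub_mulVec_of_eq_zero d σ v x h)))
    obtain ⟨y, rfl⟩ : ∃ y : V → ℕ, x = y + Pi.single v 1 := by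
      refine ⟨x - Pi.single v 1, ?_⟩
      ext w
      by_cases h : w = v
      · subst h; simp; omega
      · simp [h]
    rw [← fire_sub_mulVec] at hx
    have hy : ∑ w, y w = n := by
      simpa [Finset.sum_add_distrib] using hn
    obtain ⟨τ, hτ, hs⟩ := ih (fire d σ v) y hy hx
    exact ⟨τ, .head ⟨v, hv, rfl⟩ hτ, hs⟩

theorem exists_eq_sub_mulVec_of_reflTransGen (d : V → V → ℕ) (σ τ : V → ℤ)
    (h : Relation.ReflTransGen (LegalStep d) σ τ) :
    ∃ x : V → ℕ, τ = σ - (lap d).mulVec (fun v => (x v : ℤ)) := by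
  induction h using Relation.ReflTransGen.head_induction_on with
  | refl => exact ⟨0, by ext v; simp [Matrix.mulVec, dotProduct]⟩
  | head hstep _ ih =>
    obtain ⟨v, _, rfl⟩ := hstep
    obtain ⟨x, rfl⟩ := ih
    exact ⟨x + Pi.single v 1, fire_sub_mulVec d _ v x⟩

theorem stmt14 (d : V → V → ℕ) (σ : V → ℤ) :
    Stabilizes d σ ↔ ∃ x : V → ℕ, Stable d (σ - (lap d).mulVec (fun v => (x v : ℤ))) := by
  constructor
  · rintro ⟨τ, hτ, hs⟩
    obtain ⟨x, rfl⟩ := exists_eq_sub_mulVec_of_reflTransGen d σ τ hτ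
    exact ⟨x, hs⟩
  · rintro ⟨x, hx⟩
    exact stabilizes_of_stable_sub_mulVec d _ σ x rfl hx
end

section
/- Let n ≥ 2 and let L be a subgroup of ℤ^n_0 of rank n−1 (equivalently, of finite index d = [ℤ^n_0 : L]). Then there exists a strongly connected directed multigraph G on n vertices whose Laplacian Δ satisfies Δℤ^n = L, and all entries of Δ are bounded in absolute value by n·d. -/
open Finset

variable {V : Type} [Fintype V] [DecidableEq V]

/-- A vector whose entries off `k` are nonpositive and at least `-b` and whose coordinates sum to
zero is a possible column of index `k` of a graph Laplacian. -/
structure IsLapColumn {n : ℕ} (b : ℤ) (k : Fin n) (h : Fin n → ℤ) : Prop where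
  sum_eq_zero : ∑ j, h j = 0
  nonpos : ∀ j, j ≠ k → h j ≤ 0
  neg_le : ∀ j, j ≠ k → -b ≤ h j

/-- The multigraph whose Laplacian has columns `C v`. -/
def graphOfColumns {n : ℕ} (C : Fin n → Fin n → ℤ) (v w : Fin n) : ℕ :=
  if v = w then 0 else (-C v w).toNat

lemma lap_graphOfColumns {n : ℕ} {b : ℤ} {C : Fin n → Fin n → ℤ}
    (hC : ∀ v, IsLapColumn b v (C v)) (w v : Fin n) :
    lap (graphOfColumns C) w v = C v w := by
  have off : ∀ v w, v ≠ w → (graphOfColumns C v w : ℤ) = -C v w := by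
    intro v w hvw
    have := (hC v).nonpos w hvw.symm
    simp only [graphOfColumns, if_neg hvw]
    omega
  by_cases hwv : w = v
  · subst hwv
    simp only [lap, Matrix.of_apply, if_true, outdeg]
    push_cast
    have h0 := (hC w).sum_eq_zero
    rw [← Finset.add_sum_erase _ _ (Finset.mem_univ w)] at h0 ⊢
    have : ∑ x ∈ univ.erase w, (graphOfColumns C w x : ℤ) = -∑ x ∈ univ.erase w, C w x := by
      rw [← Finset.sum_neg_distrib]
      exact Finset.sum_congr rfl fun x hx => off w x (Finset.ne_of_mem_erase hx).symm
    omega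
  · simp only [lap, Matrix.of_apply, if_neg hwv]
    rw [off v w (Ne.symm hwv), neg_neg]

lemma IsLapColumn.abs_apply_le {n : ℕ} {b : ℤ} (hb : 0 ≤ b) {k : Fin n} {h : Fin n → ℤ}
    (hh : IsLapColumn b k h) (j : Fin n) : |h j| ≤ n * b := by
  have hn : (1 : ℤ) ≤ n := by exact_mod_cast k.pos
  by_cases hj : j = k
  · subst hj
    have h0 := hh.sum_eq_zero
    rw [← Finset.add_sum_erase _ _ (Finset.mem_univ j)] at h0
    have h1 : ∑ x ∈ univ.erase j, h x ≤ 0 :=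
      Finset.sum_nonpos fun x hx => hh.nonpos x (Finset.ne_of_mem_erase hx)
    have h2 : ∑ x ∈ univ.erase j, (-b) ≤ ∑ x ∈ univ.erase j, h x :=
      Finset.sum_le_sum fun x hx => hh.neg_le x (Finset.ne_of_mem_erase hx)
    have h3 : ∑ x ∈ univ.erase j, (-b) = -((n - 1) * b) := by
      rw [Finset.sum_const, Finset.card_erase_of_mem (Finset.mem_univ j), Finset.card_univ,
        Fintype.card_fin, nsmul_eq_mul, Nat.cast_sub j.pos]
      push_cast
      ring
    rw [abs_le]
    constructor <;> nlinarith
  · have h1 := hh.nonpos j hj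
    have h2 := hh.neg_le j hj
    rw [abs_le]
    constructor <;> nlinarith

lemma lapLattice_graphOfColumns {n : ℕ} {b : ℤ} {C : Fin n → Fin n → ℤ}
    (hC : ∀ v, IsLapColumn b v (C v)) :
    lapLattice (graphOfColumns C) = Submodule.span ℤ (Set.range C) := by
  rw [lapLattice, Matrix.range_mulVecLin]
  congr 2
  funext v w
  exact lap_graphOfColumns hC w v

/-- If every column `i + 1` is nonzero in coordinate `i`, and the column `0` has no zero entry off
the diagonal, then the graph is strongly connected. -/
lemma stronglyConnected_graphOfColumns {m : ℕ} {C : Fin (m + 1) → Fin (m + 1) → ℤ}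
    (h0 : ∀ j, j ≠ 0 → C 0 j < 0) (hs : ∀ i : Fin m, C i.succ i.castSucc < 0) :
    StronglyConnected (graphOfColumns C) := by
  intro u v
  have down : Relation.ReflTransGen (fun a b => 1 ≤ graphOfColumns C a b) u 0 := by
    induction u using Fin.induction with
    | zero => exact .refl
    | succ i ih =>
      refine .head ?_ ih
      have := hs i
      simp only [graphOfColumns, if_neg i.castSucc_lt_succ.ne']
      omega
  by_cases hv : v = 0
  · exact hv ▸ down
  · refine down.tail ?_
    have := h0 v hv
    simp only [graphOfColumns, if_neg (Ne.symm hv)]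
    omega

/-- The index of `L` in the zero-sum lattice multiplies the zero-sum lattice into `L`. -/
lemma index_smul_mem {n : ℕ} {L : Submodule ℤ (Fin n → ℤ)} {b : ℕ}
    (hindex : (L.toAddSubgroup.addSubgroupOf (zeroSum (Fin n)).toAddSubgroup).index = b)
    (y : Fin n → ℤ) (hy : ∑ j, y j = 0) : (b : ℤ) • y ∈ L := by
  have := AddSubgroup.nsmul_index_mem
    (L.toAddSubgroup.addSubgroupOf (zeroSum (Fin n)).toAddSubgroup) ⟨y, hy⟩
  rw [hindex, AddSubgroup.mem_addSubgroupOf] at this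
  simpa using this

/-- Reducing the coordinates after `k` modulo `b`, and letting the coordinate `k` absorb the
change. -/
lemma exists_reduced {n : ℕ} {L : Submodule ℤ (Fin n → ℤ)} {b : ℤ} (hb : 0 < b)
    (hbL : ∀ y : Fin n → ℤ, ∑ j, y j = 0 → b • y ∈ L) (k : Fin n)
    {h : Fin n → ℤ} (hh : h ∈ L) :
    ∃ h' ∈ L, (∀ j < k, h' j = h j) ∧ ∀ j, k < j → -b ≤ h' j ∧ h' j ≤ 0 := by
  let q : Fin n → ℤ := fun j => if k < j then -(h j / b) - 1 else 0
  let y : Fin n → ℤ := q - Pi.single k (∑ j, q j)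
  refine ⟨h + b • y, L.add_mem hh (hbL y ?_), fun j hj => ?_, fun j hj => ?_⟩
  · simp [y, Finset.sum_sub_distrib]
  · simp [y, q, hj.not_gt, hj.ne]
  · have hval : (h + b • y) j = h j % b - b := by
      have := Int.emod_add_mul_ediv (h j) b
      simp only [Pi.add_apply, Pi.smul_apply, smul_eq_mul, y, q, Pi.sub_apply, if_pos hj,
        Pi.single_eq_of_ne hj.ne']
      linarith
    have h1 := Int.emod_nonneg (h j) hb.ne'
    have h2 := Int.emod_lt_of_pos (h j) hb
    rw [hval]
    constructor <;> linarith

/-- A lattice element vanishing before coordinate `i` whose coordinate `i` is negative and generates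
the ideal of all possible such coordinates. -/
lemma exists_pivot {m : ℕ} {L : Submodule ℤ (Fin (m + 1) → ℤ)} {b : ℤ} (hb : 0 < b)
    (hbL : ∀ y : Fin (m + 1) → ℤ, ∑ j, y j = 0 → b • y ∈ L) (i : Fin m) :
    ∃ h ∈ L, (∀ j < i.castSucc, h j = 0) ∧ h i.castSucc < 0 ∧ -b ≤ h i.castSucc ∧
      ∀ x ∈ L, (∀ j < i.castSucc, x j = 0) → h i.castSucc ∣ x i.castSucc := by
  let W : Submodule ℤ (Fin (m + 1) → ℤ) :=
    L ⊓ ⨅ j : {j : Fin (m + 1) // j < i.castSucc}, LinearMap.ker (LinearMap.proj j.1)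
  have mem_W : ∀ x, x ∈ W ↔ x ∈ L ∧ ∀ j < i.castSucc, x j = 0 := by
    intro x
    simp [W, Submodule.mem_inf, Submodule.mem_iInf]
  let S : Submodule ℤ ℤ := W.map (LinearMap.proj i.castSucc)
  obtain ⟨g, hg⟩ := (inferInstance : S.IsPrincipal).principal
  have mem_S : ∀ x ∈ L, (∀ j < i.castSucc, x j = 0) → g ∣ x i.castSucc := by
    intro x hx hx0
    have : x i.castSucc ∈ S := ⟨x, (mem_W x).2 ⟨hx, hx0⟩, rfl⟩
    rw [hg] at this
    exact Ideal.mem_span_singleton.1 this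
  have hgb : g ∣ b := by
    have h1 := hbL (Pi.single i.castSucc 1 - Pi.single i.succ 1) (by simp)
    have h2 := mem_S _ h1 fun j hj => by
      simp [hj.ne, (hj.trans i.castSucc_lt_succ).ne]
    simpa [i.castSucc_lt_succ.ne] using h2
  have hg0 : g ≠ 0 := by
    rintro rfl
    exact hb.ne' (zero_dvd_iff.1 hgb)
  have hgS : -|g| ∈ S := by
    rw [hg]
    exact Ideal.mem_span_singleton.2 ((dvd_neg).2 ((dvd_abs g g).2 dvd_rfl))
  obtain ⟨h, hh, hhg⟩ := hgS
  rw [LinearMap.proj_apply] at hhg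
  obtain ⟨hL, hz⟩ := (mem_W h).1 hh
  refine ⟨h, hL, hz, ?_, ?_, fun x hx hx0 => ?_⟩
  · rw [hhg]
    exact neg_neg_of_pos (abs_pos.2 hg0)
  · rw [hhg]
    exact neg_le_neg (Int.le_of_dvd hb ((abs_dvd g b).2 hgb))
  · rw [hhg, neg_dvd, abs_dvd]
    exact mem_S x hx hx0

/-- Triangular elimination: pivots in all coordinates but the last generate a lattice of zero-sum
vectors. -/
lemma le_span_of_pivots {m : ℕ} {L : Submodule ℤ (Fin (m + 1) → ℤ)}
    (hL : ∀ x ∈ L, ∑ j, x j = 0) {H : Fin m → Fin (m + 1) → ℤ} (hH : ∀ i, H i ∈ L)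
    (hz : ∀ i, ∀ j < i.castSucc, H i j = 0)
    (hdvd : ∀ i : Fin m, ∀ x ∈ L, (∀ j < i.castSucc, x j = 0) →
      H i i.castSucc ∣ x i.castSucc) :
    L ≤ Submodule.span ℤ (Set.range H) := by
  have key : ∀ i : Fin (m + 1), ∀ x ∈ L, (∀ j < i, x j = 0) →
      x ∈ Submodule.span ℤ (Set.range H) := by
    intro i
    induction i using Fin.reverseInduction with
    | last =>
      intro x hx hx0
      have hlast := hL x hx
      rw [Fin.sum_univ_castSucc,
        Finset.sum_eq_zero fun j _ => hx0 j.castSucc j.castSucc_lt_last, zero_add] at hlast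
      have : x = 0 := by
        funext j
        rcases (Fin.le_last j).lt_or_eq with h | h
        · exact hx0 j h
        · rw [h]
          exact hlast
      rw [this]
      exact zero_mem _
    | cast i ih =>
      intro x hx hx0
      obtain ⟨c, hc⟩ := hdvd i x hx hx0
      have h1 : x - c • H i ∈ Submodule.span ℤ (Set.range H) := by
        refine ih _ (L.sub_mem hx (L.smul_mem c (hH i))) fun j hj => ?_
        rcases (Fin.le_castSucc_iff.2 hj).lt_or_eq with h | h
        · simp [hx0 j h, hz i j h]
        · subst h
          simp [hc, mul_comm]
      have h2 := Submodule.add_mem _ h1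
        (Submodule.smul_mem _ c (Submodule.subset_span (Set.mem_range_self i)))
      rwa [sub_add_cancel] at h2
  exact fun x hx => key 0 x hx fun j hj => absurd hj (Fin.not_lt_zero j)

theorem stmt16 (n : ℕ) (hn : 2 ≤ n) (L : Submodule ℤ (Fin n → ℤ))
    (hL : L ≤ zeroSum (Fin n)) (dd : ℕ) (hdd : 0 < dd)
    (hindex : (L.toAddSubgroup.addSubgroupOf (zeroSum (Fin n)).toAddSubgroup).index = dd) :
    ∃ δ : Fin n → Fin n → ℕ, StronglyConnected δ ∧ lapLattice δ = L ∧
      ∀ v w, |lap δ v w| ≤ (n : ℤ) * dd := by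
  obtain ⟨m, rfl⟩ : ∃ m, n = m + 1 := ⟨n - 1, by omega⟩
  have hb : (0 : ℤ) < dd := by exact_mod_cast hdd
  have hbL := index_smul_mem hindex
  have hcol : ∀ i : Fin m, ∃ h ∈ L, (∀ j < i.castSucc, h j = 0) ∧ h i.castSucc < 0 ∧
      (∀ x ∈ L, (∀ j < i.castSucc, x j = 0) → h i.castSucc ∣ x i.castSucc) ∧
      IsLapColumn (dd : ℤ) i.succ h := by
    intro i
    obtain ⟨h₀, h₀L, h₀z, h₀neg, h₀le, h₀dvd⟩ := exists_pivot hb hbL i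
    obtain ⟨h, hhL, hlt, hgt⟩ := exists_reduced hb hbL i.succ h₀L
    have hi : h i.castSucc = h₀ i.castSucc := hlt _ i.castSucc_lt_succ
    have hz : ∀ j < i.castSucc, h j = 0 := fun j hj =>
      (hlt j (hj.trans i.castSucc_lt_succ)).trans (h₀z j hj)
    have hoff : ∀ j, j ≠ i.succ → -(dd : ℤ) ≤ h j ∧ h j ≤ 0 := by
      intro j hj
      rcases hj.lt_or_gt with h' | h'
      · rcases (Fin.le_castSucc_iff.2 h').lt_or_eq with h'' | rfl
        · rw [hz j h'']
          constructor <;> linarith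
        · rw [hi]
          exact ⟨h₀le, h₀neg.le⟩
      · exact hgt j h'
    exact ⟨h, hhL, hz, hi ▸ h₀neg, hi ▸ h₀dvd,
      hL hhL, fun j hj => (hoff j hj).2, fun j hj => (hoff j hj).1⟩
  choose H hHL hHz hHneg hHdvd hHcol using hcol
  let c₀ : Fin (m + 1) → ℤ := (dd : ℤ) • (Pi.single 0 ((m : ℤ) + 1) - 1)
  have hc₀L : c₀ ∈ L := hbL _ (by simp)
  have hc₀ : ∀ j, j ≠ 0 → c₀ j = -dd := fun j hj => by simp [c₀, hj]
  let C : Fin (m + 1) → Fin (m + 1) → ℤ := Fin.cons c₀ H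
  have hCcol : ∀ v, IsLapColumn (dd : ℤ) v (C v) := by
    refine Fin.cases ⟨hL hc₀L, fun j hj => ?_, fun j hj => (hc₀ j hj).ge⟩ hHcol
    have := hc₀ j hj
    simp only [C, Fin.cons_zero]
    omega
  refine ⟨graphOfColumns C, stronglyConnected_graphOfColumns (fun j hj => ?_) hHneg, ?_,
    fun v w => ?_⟩
  · have := hc₀ j hj
    simp only [C, Fin.cons_zero]
    omega
  · rw [lapLattice_graphOfColumns hCcol]
    apply le_antisymm
    · rw [Submodule.span_le]
      rintro _ ⟨v, rfl⟩
      exact Fin.cases (motive := fun v => C v ∈ L) hc₀L hHL v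
    · refine (le_span_of_pivots (fun x hx => hL hx) hHL hHz hHdvd).trans (Submodule.span_mono ?_)
      rintro _ ⟨i, rfl⟩
      exact ⟨i.succ, rfl⟩
  · rw [lap_graphOfColumns hCcol]
    exact (hCcol w).abs_apply_le hb.le v
end
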